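/- Fix n ≥ 2 and work in the exterior-form model Σ := ⋀•(ℂ^{2n−1}) with ω := Σ_{p=1}^{n−1} y_{2p}∧y_{2p+1}. Let Σ_inv := span_ℂ{ ω^k, y₁∧ω^k : 0 ≤ k ≤ n−1 }, and for −1 ≤ k ≤ n−1 set ψ_k := ω^{k+1} − i(k+1)·y₁∧ω^k (with ω^{−1} := 0, ω⁰ := 1; note ω^n = 0, so ψ_k ∈ Σ_inv). Then: (1) the n+1 elements ψ_{−1}, ψ₀, …, ψ_{n−1} are linearly independent; (2) each ψ_k satisfies ( c_{4p} + c₁∘c_{4p+1} + c₂∘c_{4p+2} + c₃∘c_{4p+3} )(ψ_k) = 0 for every p = 1, …, n−1; and (3) conversely, every ψ ∈ Σ_inv satisfying ( c_{4p} + c₁∘c_{4p+1} + c₂∘c_{4p+2} + c₃∘c_{4p+3} )(ψ) = 0 for all p = 1, …, n−1 lies in span_ℂ{ψ_{−1}, …, ψ_{n−1}}. (This is the algebraic content of the theorem that the invariant Riemannian Killing spinors on a simply-connected homogeneous 3-Sasakian manifold of dimension 4n−1 have basis ψ_{−1}, …, ψ_{n−1}: the displayed equations express the Killing equation ∇^g_X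 ψ = (1/2)X·ψ in the horizontal directions X = e_{4p} via the canonical connection.) -/

import Mathlib

noncomputable section

/-- The underlying `(2n-1)`-dimensional complex vector space `ℂ^{2n-1}`. -/
abbrev ModelV (n : ℕ) : Type := Fin (2 * n - 1) → ℂ

/-- The exterior-form model `Σ = ⋀•(ℂ^{2n-1})` of the spinor module. -/
abbrev SpinorModel (n : ℕ) : Type := ExteriorAlgebra ℂ (ModelV n)

/-- The generator `y_{j+1}` (so `j` is the 0-based index), with junk value `0` out of range. -/
def yGen (n j : ℕ) : SpinorModel n :=
  if h : j < 2 * n - 1 then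
    ExteriorAlgebra.ι ℂ (Pi.single (⟨j, h⟩ : Fin (2 * n - 1)) (1 : ℂ))
  else 0

/-- Left exterior multiplication `y_{j+1} ∧ ·` (0-based index `j`). -/
def wdg (n j : ℕ) : SpinorModel n →ₗ[ℂ] SpinorModel n :=
  LinearMap.mulLeft ℂ (yGen n j)

/-- Contraction `x_{j+1} ⌟ ·` with the `(j+1)`-st dual basis vector (0-based index `j`),
with junk value `0` out of range. -/
def ctr (n j : ℕ) : SpinorModel n →ₗ[ℂ] SpinorModel n :=
  if h : j < 2 * n - 1 then
    CliffordAlgebra.contractLeft (LinearMap.proj (⟨j, h⟩ : Fin (2 * n - 1)))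
  else 0

/-- The Clifford multiplication operators `c_a`, `1 ≤ a ≤ 4n-1`, of the exterior-form model:
`c₁ = i·Id` on even degrees and `-i·Id` on odd degrees, `c_{2j} = i(x_j⌟ + y_j∧)` and
`c_{2j+1} = y_j∧ - x_j⌟` for `1 ≤ j ≤ 2n-1` (1-based indices). -/
def cop (n a : ℕ) : SpinorModel n →ₗ[ℂ] SpinorModel n :=
  if a = 1 then
    Complex.I • (CliffordAlgebra.involute : SpinorModel n →ₐ[ℂ] SpinorModel n).toLinearMap
  else if a % 2 = 0 then Complex.I • (ctr n (a / 2 - 1) + wdg n (a / 2 - 1))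
  else wdg n (a / 2 - 1) - ctr n (a / 2 - 1)

/-- The invariant `2`-form `ω = ∑_{p=1}^{n-1} y_{2p} ∧ y_{2p+1}`. -/
def om (n : ℕ) : SpinorModel n :=
  ∑ p ∈ Finset.Icc 1 (n - 1), yGen n (2 * p - 1) * yGen n (2 * p)

/-- The invariant Killing spinors `ψ_k = ω^{k+1} - i(k+1)·y₁∧ω^k`, reindexed by
`j = k + 1` (so `psi n j` is `ψ_{j-1}`, and `psi n 0 = ψ_{-1} = 1`). -/
def psi (n j : ℕ) : SpinorModel n :=
  om n ^ j - (Complex.I * (j : ℂ)) • (yGen n 0 * om n ^ (j - 1))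

/-- The space of invariant spinors `Σ_inv = span_ℂ{ω^k, y₁∧ω^k : 0 ≤ k ≤ n-1}`. -/
def Sinv (n : ℕ) : Submodule ℂ (SpinorModel n) :=
  Submodule.span ℂ {x | ∃ k ≤ n - 1, x = om n ^ k ∨ x = yGen n 0 * om n ^ k}

/-- The space of invariant Killing spinors `K = span_ℂ{ψ_k : -1 ≤ k ≤ n-1}`. -/
def KSpan (n : ℕ) : Submodule ℂ (SpinorModel n) :=
  Submodule.span ℂ {x | ∃ j ≤ n, x = psi n j}

section ChainIndependence

variable {K V : Type*} [Field K] [AddCommGroup V] [Module K V]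

/-- The iterates of a vector under an endomorphism are linearly independent up to the last
nonzero one. -/
theorem linearIndependent_pow_apply (f : Module.End K V) (m : ℕ) :
    ∀ v : V, (f ^ m) v ≠ 0 → (f ^ (m + 1)) v = 0 →
      LinearIndependent K (fun k : Fin (m + 1) => (f ^ (k : ℕ)) v) := by
  induction m with
  | zero =>
    intro v hv _
    rw [zero_add]
    exact LinearIndependent.of_subsingleton (0 : Fin 1) (by simpa using hv)
  | succ m ih =>
    intro v hv hv'
    rw [linearIndependent_finSucc]
    constructor
    · have := ih (f v) (by simpa [pow_succ] using hv) (by simpa [pow_succ] using hv')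
      simpa [Fin.tail_def, pow_succ] using this
    · intro hmem
      have hle : Submodule.span K (Set.range (Fin.tail
          (fun k : Fin (m + 1 + 1) => (f ^ (k : ℕ)) v))) ≤ LinearMap.ker (f ^ (m + 1)) := by
        rw [Submodule.span_le]
        rintro _ ⟨k, rfl⟩
        have hk : m + 1 + ((k : ℕ) + 1) = (k : ℕ) + (m + 1 + 1) := by omega
        simp only [Fin.tail_def, Fin.val_succ, SetLike.mem_coe, LinearMap.mem_ker]
        rw [← Module.End.mul_apply, ← pow_add, hk, pow_add, Module.End.mul_apply, hv', map_zero]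
      exact hv (by simpa using hle hmem)

end ChainIndependence

/-- A sum of `m` pairwise commuting elements of square zero has vanishing `(m + 1)`-st power. -/
theorem sum_pow_card_succ_eq_zero {R ι : Type*} [Ring R] (s : Finset ι) (f : ι → R)
    (hc : ∀ i j, Commute (f i) (f j)) (hf : ∀ i, f i * f i = 0) :
    (∑ i ∈ s, f i) ^ (s.card + 1) = 0 := by
  classical
  induction s using Finset.induction_on with
  | empty => simp
  | insert a s ha ih =>
    rw [Finset.sum_insert ha, Finset.card_insert_of_notMem ha]
    have hsq : f a ^ 2 = 0 := by rw [pow_two, hf]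
    have hcomm := Commute.sum_right s f (f a) fun i _ => hc a i
    exact hcomm.add_pow_eq_zero_of_add_le_succ_of_pow_eq_zero
      hsq ih (by omega)

section Generators

variable {n : ℕ}

theorem yGen_mul_self (i : ℕ) : yGen n i * yGen n i = 0 := by
  unfold yGen
  split
  · exact ExteriorAlgebra.ι_sq_zero _
  · simp

theorem yGen_mul_swap (i j : ℕ) : yGen n i * yGen n j = -(yGen n j * yGen n i) := by
  unfold yGen
  split
  · split
    · exact eq_neg_of_add_eq_zero_left (ExteriorAlgebra.ι_add_mul_swap _ _)
    · simp
  · simp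

theorem commute_yGen_mul_yGen (i j k : ℕ) : Commute (yGen n k) (yGen n i * yGen n j) := by
  rw [Commute, SemiconjBy, ← mul_assoc, yGen_mul_swap k i, neg_mul, mul_assoc, yGen_mul_swap k j]
  simp [mul_assoc]

theorem commute_yGen_om (j : ℕ) : Commute (yGen n j) (om n) :=
  Commute.sum_right _ _ _ fun _ _ => commute_yGen_mul_yGen _ _ _

theorem om_pow_self (hn : 2 ≤ n) : om n ^ n = 0 := by
  have h := sum_pow_card_succ_eq_zero (Finset.Icc 1 (n - 1))
    (fun p => yGen n (2 * p - 1) * yGen n (2 * p))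
    (fun i j => (commute_yGen_mul_yGen _ _ _).mul_left (commute_yGen_mul_yGen _ _ _))
    (fun i => by
      rw [mul_assoc, (commute_yGen_mul_yGen _ _ _).eq, mul_assoc, yGen_mul_self]; simp)
  rwa [Nat.card_Icc, show n - 1 + 1 - 1 + 1 = n by omega] at h

theorem involute_yGen (i : ℕ) :
    CliffordAlgebra.involute (yGen n i : SpinorModel n) = -yGen n i := by
  unfold yGen
  split
  · exact CliffordAlgebra.involute_ι _
  · simp

theorem involute_om : CliffordAlgebra.involute (om n : SpinorModel n) = om n := by
  simp [om, involute_yGen]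

theorem ctr_one (j : ℕ) : ctr n j 1 = 0 := by
  unfold ctr
  split
  · exact CliffordAlgebra.contractLeft_one (Q := 0) _
  · simp

theorem ctr_yGen_mul {i j : ℕ} (hj : j < 2 * n - 1) (z : SpinorModel n) :
    ctr n j (yGen n i * z) = (if i = j then z else 0) - yGen n i * ctr n j z := by
  rw [ctr, dif_pos hj]
  by_cases hi : i < 2 * n - 1
  · rw [yGen, dif_pos hi]
    refine (CliffordAlgebra.contractLeft_ι_mul _ _ _).trans ?_
    congr 1
    rw [LinearMap.proj_apply, Pi.single_apply]
    simp only [Fin.mk.injEq, eq_comm (a := j), ite_smul, one_smul, zero_smul]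
  · rw [yGen, dif_neg hi, if_neg (by omega)]
    simp

theorem yGen_ne_zero {j : ℕ} (hj : j < 2 * n - 1) : yGen n j ≠ 0 := by
  intro h
  have := ctr_yGen_mul (i := j) hj (1 : SpinorModel n)
  simp [h, ctr_one] at this

theorem ctr_om_mul {j : ℕ} (hj : j < 2 * n - 1) (z : SpinorModel n) :
    ctr n j (om n * z) = (∑ p ∈ Finset.Icc 1 (n - 1),
      ((if 2 * p - 1 = j then yGen n (2 * p) else 0) -
        (if 2 * p = j then yGen n (2 * p - 1) else 0))) * z + om n * ctr n j z := by
  rw [om, Finset.sum_mul, map_sum, Finset.sum_mul, Finset.sum_mul, ← Finset.sum_add_distrib]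
  refine Finset.sum_congr rfl fun p _ => ?_
  rw [mul_assoc, ctr_yGen_mul hj, ctr_yGen_mul hj]
  split_ifs <;> simp only [sub_mul, mul_sub, mul_assoc, zero_mul, mul_zero] <;> abel

theorem ctr_zero_om_mul (hn : 2 ≤ n) (z : SpinorModel n) :
    ctr n 0 (om n * z) = om n * ctr n 0 z := by
  rw [ctr_om_mul (by omega), Finset.sum_eq_zero, zero_mul, zero_add]
  intro p hp
  rw [Finset.mem_Icc] at hp
  rw [if_neg (by omega), if_neg (by omega), sub_zero]

theorem ctr_fst_om_mul {p : ℕ} (hp : p ∈ Finset.Icc 1 (n - 1)) (z : SpinorModel n) :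
    ctr n (2 * p - 1) (om n * z) = yGen n (2 * p) * z + om n * ctr n (2 * p - 1) z := by
  have hp' := Finset.mem_Icc.mp hp
  rw [ctr_om_mul (by omega), Finset.sum_eq_single_of_mem p hp, if_pos rfl, if_neg (by omega),
    sub_zero]
  intro q hq hqp
  rw [Finset.mem_Icc] at hq
  rw [if_neg (by omega), if_neg (by omega), sub_zero]

theorem ctr_snd_om_mul {p : ℕ} (hp : p ∈ Finset.Icc 1 (n - 1)) (z : SpinorModel n) :
    ctr n (2 * p) (om n * z) = -yGen n (2 * p - 1) * z + om n * ctr n (2 * p) z := by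
  have hp' := Finset.mem_Icc.mp hp
  rw [ctr_om_mul (by omega), Finset.sum_eq_single_of_mem p hp, if_pos rfl, if_neg (by omega),
    zero_sub]
  intro q hq hqp
  rw [Finset.mem_Icc] at hq
  rw [if_neg (by omega), if_neg (by omega), sub_zero]

theorem ctr_om_pow {j : ℕ} {η : SpinorModel n} (hη : Commute η (om n))
    (h : ∀ z, ctr n j (om n * z) = η * z + om n * ctr n j z) (k : ℕ) :
    ctr n j (om n ^ k) = (k : ℂ) • (η * om n ^ (k - 1)) := by
  induction k with
  | zero => simp [ctr_one]
  | succ k ih =>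
    rw [pow_succ', h, ih]
    cases k with
    | zero => simp
    | succ k =>
      have : om n * (η * om n ^ k) = η * om n ^ (k + 1) := by
        rw [← mul_assoc, ← hη.eq, mul_assoc, ← pow_succ']
      rw [Nat.add_sub_cancel, Nat.add_sub_cancel, mul_smul_comm, this, Nat.cast_succ (k + 1),
        add_smul, one_smul, add_comm]

theorem ctr_zero_om_pow (hn : 2 ≤ n) (k : ℕ) : ctr n 0 (om n ^ k) = 0 := by
  rw [ctr_om_pow (η := 0) (Commute.zero_left _) (fun z => by rw [ctr_zero_om_mul hn]; simp)]
  simp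

theorem ctr_fst_om_pow {p : ℕ} (hp : p ∈ Finset.Icc 1 (n - 1)) (k : ℕ) :
    ctr n (2 * p - 1) (om n ^ k) = (k : ℂ) • (yGen n (2 * p) * om n ^ (k - 1)) :=
  ctr_om_pow (commute_yGen_om _) (ctr_fst_om_mul hp) k

theorem ctr_snd_om_pow {p : ℕ} (hp : p ∈ Finset.Icc 1 (n - 1)) (k : ℕ) :
    ctr n (2 * p) (om n ^ k) = -((k : ℂ) • (yGen n (2 * p - 1) * om n ^ (k - 1))) := by
  rw [ctr_om_pow (commute_yGen_om _).neg_left (ctr_snd_om_mul hp) k, neg_mul, smul_neg]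

/-- The Lefschetz lowering operator `∑_p x_{2p+1} ⌟ x_{2p} ⌟` applied to `y₁ ∧ ω^{k+1}`. -/
theorem sum_ctr_ctr_yGen_zero_mul_om_pow (hn : 2 ≤ n) (k : ℕ) :
    ∑ p ∈ Finset.Icc 1 (n - 1), ctr n (2 * p) (ctr n (2 * p - 1) (yGen n 0 * om n ^ (k + 1))) =
      ((k + 1 : ℂ) * ((n : ℂ) - 1 - k)) • (yGen n 0 * om n ^ k) := by
  have hterm : ∀ p ∈ Finset.Icc 1 (n - 1),
      ctr n (2 * p) (ctr n (2 * p - 1) (yGen n 0 * om n ^ (k + 1))) =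
        (k + 1 : ℂ) • (yGen n 0 * om n ^ k) - ((k + 1 : ℂ) * k) •
          (yGen n 0 * (yGen n (2 * p - 1) * yGen n (2 * p) * om n ^ (k - 1))) := by
    intro p hp
    have hp' := Finset.mem_Icc.mp hp
    rw [ctr_yGen_mul (by omega), if_neg (by omega), zero_sub, ctr_fst_om_pow hp, map_neg,
      Nat.add_sub_cancel, mul_smul_comm, map_smul, ctr_yGen_mul (by omega), if_neg (by omega),
      zero_sub, ctr_yGen_mul (by omega), if_pos rfl, ctr_snd_om_pow hp,
      yGen_mul_swap (2 * p - 1)]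
    rw [mul_neg, sub_neg_eq_add, mul_smul_comm, mul_add, mul_smul_comm, neg_mul, mul_neg, mul_assoc,
      Nat.cast_succ, smul_neg, neg_neg, smul_neg, sub_neg_eq_add, smul_add, smul_smul]
  rw [Finset.sum_congr rfl hterm, Finset.sum_sub_distrib, Finset.sum_const, ← Finset.smul_sum,
    ← Finset.mul_sum, ← Finset.sum_mul, ← om, Nat.card_Icc, ← Nat.cast_smul_eq_nsmul ℂ,
    Nat.add_sub_cancel, Nat.cast_pred (by omega)]
  cases k with
  | zero => simp
  | succ k =>
    rw [Nat.add_sub_cancel, ← pow_succ']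
    module

theorem yGen_zero_mul_om_pow_ne_zero (hn : 2 ≤ n) {k : ℕ} (hk : k < n) :
    yGen n 0 * om n ^ k ≠ 0 := by
  induction k with
  | zero => simpa using yGen_ne_zero (n := n) (j := 0) (by omega)
  | succ k ih =>
    intro h
    have hL := sum_ctr_ctr_yGen_zero_mul_om_pow hn k
    simp only [h, map_zero, Finset.sum_const_zero] at hL
    rcases smul_eq_zero.mp hL.symm with h0 | h0
    · rcases mul_eq_zero.mp h0 with h1 | h1
      · exact Nat.cast_add_one_ne_zero k h1
      · have h2 : (n : ℂ) = ((1 + k : ℕ) : ℂ) := by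
          push_cast
          linear_combination h1
        have := Nat.cast_injective h2
        omega
    · exact ih (by omega) h0

theorem linearIndependent_yGen_zero_mul_om_pow (hn : 2 ≤ n) :
    LinearIndependent ℂ (fun k : Fin n => yGen n 0 * om n ^ (k : ℕ)) := by
  obtain ⟨m, rfl⟩ : ∃ m, n = m + 1 := ⟨n - 1, by omega⟩
  have hpow : ∀ k : ℕ, (LinearMap.mulLeft ℂ (om (m + 1)) ^ k) (yGen (m + 1) 0) =
      yGen (m + 1) 0 * om (m + 1) ^ k := fun k => by
    rw [LinearMap.pow_mulLeft, LinearMap.mulLeft_apply, ((commute_yGen_om 0).pow_right k).eq]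
  have := linearIndependent_pow_apply (LinearMap.mulLeft ℂ (om (m + 1))) m (yGen (m + 1) 0)
    (by rw [hpow]; exact yGen_zero_mul_om_pow_ne_zero hn (by omega))
    (by rw [hpow, om_pow_self hn, mul_zero])
  simpa only [hpow] using this

theorem yGen_zero_mul_psi (j : ℕ) : yGen n 0 * psi n j = yGen n 0 * om n ^ j := by
  simp [psi, mul_sub, ← mul_assoc, yGen_mul_self]

theorem psi_self (hn : 2 ≤ n) :
    psi n n = -(Complex.I * (n : ℂ)) • (yGen n 0 * om n ^ (n - 1)) := by
  rw [psi, om_pow_self hn, zero_sub, neg_smul]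

theorem linearIndependent_psi (hn : 2 ≤ n) :
    LinearIndependent ℂ (fun j : Fin (n + 1) => psi n (j : ℕ)) := by
  rw [Fintype.linearIndependent_iff]
  intro g hg
  rw [Fin.sum_univ_castSucc] at hg
  have hcoeff : ∀ i : Fin n, g i.castSucc = 0 := by
    refine Fintype.linearIndependent_iff.mp (linearIndependent_yGen_zero_mul_om_pow hn)
      (fun i => g i.castSucc) ?_
    have := congrArg (yGen n 0 * ·) hg
    simpa [mul_add, Finset.mul_sum, yGen_zero_mul_psi, om_pow_self hn] using this
  have hlast : g (Fin.last n) = 0 := by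
    simp only [hcoeff, zero_smul, Finset.sum_const_zero, zero_add, Fin.val_last] at hg
    refine (smul_eq_zero.mp hg).resolve_right ?_
    rw [psi_self hn]
    refine smul_ne_zero (neg_ne_zero.mpr (mul_ne_zero Complex.I_ne_zero ?_))
      (yGen_zero_mul_om_pow_ne_zero hn (by omega))
    exact Nat.cast_ne_zero.mpr (by omega)
  exact Fin.lastCases hlast hcoeff

end Generators

section KillingOperator

variable {n : ℕ}

/-- The algebraic Killing operator in the horizontal direction `e_{4p}`. -/
def killingOp (n p : ℕ) : SpinorModel n →ₗ[ℂ] SpinorModel n :=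
  cop n (4 * p) + cop n 1 ∘ₗ cop n (4 * p + 1) + cop n 2 ∘ₗ cop n (4 * p + 2) +
    cop n 3 ∘ₗ cop n (4 * p + 3)

theorem killingOp_apply {p : ℕ} (hp : 1 ≤ p) (z : SpinorModel n) :
    killingOp n p z =
      Complex.I • (ctr n (2 * p - 1) z + yGen n (2 * p - 1) * z) +
      Complex.I • CliffordAlgebra.involute (yGen n (2 * p - 1) * z - ctr n (2 * p - 1) z) -
      (2 : ℂ) • ctr n 0 (yGen n (2 * p) * z) - (2 : ℂ) • (yGen n 0 * ctr n (2 * p) z) := by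
  have h0 : 4 * p / 2 - 1 = 2 * p - 1 := by omega
  have h1 : (4 * p + 1) / 2 - 1 = 2 * p - 1 := by omega
  have h2 : (4 * p + 2) / 2 - 1 = 2 * p := by omega
  have h3 : (4 * p + 3) / 2 - 1 = 2 * p := by omega
  have e0 : 4 * p ≠ 1 := by omega
  have e1 : 4 * p + 1 ≠ 1 := by omega
  have e2 : 4 * p + 2 ≠ 1 := by omega
  have e3 : 4 * p + 3 ≠ 1 := by omega
  have m0 : 4 * p % 2 = 0 := by omega
  have m1 : ¬ (4 * p + 1) % 2 = 0 := by omega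
  have m2 : (4 * p + 2) % 2 = 0 := by omega
  have m3 : ¬ (4 * p + 3) % 2 = 0 := by omega
  have hI : ∀ w : SpinorModel n, Complex.I • Complex.I • w = -w := fun w => by
    rw [smul_smul, Complex.I_mul_I, neg_one_smul]
  have c1 : cop n 1 = Complex.I •
    (CliffordAlgebra.involute : SpinorModel n →ₐ[ℂ] SpinorModel n).toLinearMap := rfl
  have c2 : cop n 2 = Complex.I • (ctr n 0 + wdg n 0) := rfl
  have c3 : cop n 3 = wdg n 0 - ctr n 0 := rfl
  rw [killingOp, c1, c2, c3, cop, cop, cop, cop, if_neg e0, if_neg e1, if_neg e2, if_neg e3,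
    if_pos m0, if_neg m1, if_pos m2, if_neg m3, h0, h1, h2, h3]
  simp only [wdg, LinearMap.add_apply, LinearMap.sub_apply, LinearMap.smul_apply,
    LinearMap.comp_apply, LinearMap.mulLeft_apply, AlgHom.toLinearMap_apply, map_add, map_sub,
    map_smul, smul_add, smul_sub, hI, two_smul]
  abel

theorem killingOp_yGen_zero_mul_om_pow (hn : 2 ≤ n) {p : ℕ} (hp : p ∈ Finset.Icc 1 (n - 1))
    (k : ℕ) :
    killingOp n p (yGen n 0 * om n ^ k) =
      (2 : ℂ) • (yGen n (2 * p) * om n ^ k) -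
        (2 * Complex.I) • (yGen n 0 * (yGen n (2 * p - 1) * om n ^ k)) := by
  have hp' := Finset.mem_Icc.mp hp
  have hsq : ∀ w : SpinorModel n, yGen n 0 * (yGen n 0 * w) = 0 := fun w => by
    rw [← mul_assoc, yGen_mul_self, zero_mul]
  have hsw : ∀ w : SpinorModel n, yGen n (2 * p - 1) * (yGen n 0 * w) =
      -(yGen n 0 * (yGen n (2 * p - 1) * w)) := fun w => by
    rw [← mul_assoc, yGen_mul_swap, neg_mul, mul_assoc]
  rw [killingOp_apply hp'.1, ctr_yGen_mul (j := 2 * p - 1) (by omega), if_neg (by omega),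
    ctr_yGen_mul (i := 2 * p) (by omega), if_neg (by omega), ctr_yGen_mul (i := 0) (by omega),
    if_pos rfl, ctr_yGen_mul (i := 0) (by omega), if_neg (by omega), ctr_zero_om_pow hn,
    ctr_fst_om_pow hp, ctr_snd_om_pow hp]
  simp only [map_sub, map_mul, map_pow, map_smul, map_neg, involute_yGen, involute_om,
    hsq, hsw, zero_sub, sub_zero, mul_neg, neg_mul, neg_neg, mul_smul_comm, mul_zero, smul_zero]
  module

theorem killingOp_om_pow (hn : 2 ≤ n) {p : ℕ} (hp : p ∈ Finset.Icc 1 (n - 1)) (k : ℕ) :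
    killingOp n p (om n ^ k) =
      (Complex.I * (k : ℂ)) • killingOp n p (yGen n 0 * om n ^ (k - 1)) := by
  have hp' := Finset.mem_Icc.mp hp
  rw [killingOp_yGen_zero_mul_om_pow hn hp, killingOp_apply hp'.1, ctr_yGen_mul (by omega),
    if_neg (by omega), ctr_zero_om_pow hn, ctr_fst_om_pow hp, ctr_snd_om_pow hp]
  simp only [map_sub, map_mul, map_pow, map_smul, involute_yGen, involute_om, mul_zero, sub_zero,
    smul_zero, mul_neg, neg_mul, mul_smul_comm, smul_sub, smul_smul]
  have hI : Complex.I * (k : ℂ) * (2 * Complex.I) = -(2 * (k : ℂ)) := by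
    linear_combination (2 * (k : ℂ)) * Complex.I_mul_I
  rw [hI]
  module

theorem killingOp_psi (hn : 2 ≤ n) {p : ℕ} (hp : p ∈ Finset.Icc 1 (n - 1)) (j : ℕ) :
    killingOp n p (psi n j) = 0 := by
  rw [psi, map_sub, map_smul, killingOp_om_pow hn hp, sub_self]

theorem sum_yGen_mul_killingOp (hn : 2 ≤ n) (k : ℕ) :
    ∑ p ∈ Finset.Icc 1 (n - 1),
        yGen n 0 * (yGen n (2 * p - 1) * killingOp n p (yGen n 0 * om n ^ k)) =
      (2 : ℂ) • (yGen n 0 * om n ^ (k + 1)) := by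
  have hterm : ∀ p ∈ Finset.Icc 1 (n - 1),
      yGen n 0 * (yGen n (2 * p - 1) * killingOp n p (yGen n 0 * om n ^ k)) =
        (2 : ℂ) • (yGen n 0 * (yGen n (2 * p - 1) * yGen n (2 * p) * om n ^ k)) := by
    intro p hp
    have hsq : yGen n (2 * p - 1) * (yGen n 0 * (yGen n (2 * p - 1) * om n ^ k)) = 0 := by
      rw [← mul_assoc, ← mul_assoc, yGen_mul_swap, neg_mul, neg_mul, mul_assoc _ _ (yGen n _),
        yGen_mul_self]
      simp
    rw [killingOp_yGen_zero_mul_om_pow hn hp, mul_sub, mul_smul_comm, mul_smul_comm, hsq,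
      smul_zero, sub_zero, mul_smul_comm, mul_assoc]
  rw [Finset.sum_congr rfl hterm, ← Finset.smul_sum, ← Finset.mul_sum, ← Finset.sum_mul, ← om,
    ← pow_succ']

/-- Modulo the spinors `ψ_k`, every invariant spinor is a combination of the `y₁ ∧ ω^k` with
`k ≤ n - 2`. -/
theorem Sinv_le_sup (hn : 2 ≤ n) :
    Sinv n ≤ Submodule.span ℂ (Set.range fun j : Fin (n + 1) => psi n (j : ℕ)) ⊔
      Submodule.span ℂ (Set.range fun k : Fin (n - 1) => yGen n 0 * om n ^ (k : ℕ)) := by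
  set P := Submodule.span ℂ (Set.range fun j : Fin (n + 1) => psi n (j : ℕ)) with hP
  set Q := Submodule.span ℂ (Set.range fun k : Fin (n - 1) => yGen n 0 * om n ^ (k : ℕ)) with hQ
  have hψ : ∀ j ≤ n, psi n j ∈ P ⊔ Q := fun j hj =>
    Submodule.mem_sup_left (Submodule.subset_span ⟨⟨j, by omega⟩, rfl⟩)
  have hy : ∀ k ≤ n - 1, yGen n 0 * om n ^ k ∈ P ⊔ Q := by
    intro k hk
    rcases hk.lt_or_eq with hlt | rfl
    · exact Submodule.mem_sup_right (Submodule.subset_span ⟨⟨k, hlt⟩, rfl⟩)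
    · have h := hψ n le_rfl
      rw [psi_self hn] at h
      refine (Submodule.smul_mem_iff _ (neg_ne_zero.mpr (mul_ne_zero Complex.I_ne_zero ?_))).mp h
      exact Nat.cast_ne_zero.mpr (by omega)
  rw [Sinv, Submodule.span_le]
  rintro _ ⟨k, hk, rfl | rfl⟩
  · have h := Submodule.add_mem _ (hψ k (by omega))
      (Submodule.smul_mem _ (Complex.I * (k : ℂ)) (hy (k - 1) (by omega)))
    rwa [psi, sub_add_cancel] at h
  · exact hy k hk

theorem mem_span_psi_of_killingOp_eq_zero (hn : 2 ≤ n) {ψ : SpinorModel n} (hψ : ψ ∈ Sinv n)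
    (h : ∀ p ∈ Finset.Icc 1 (n - 1), killingOp n p ψ = 0) :
    ψ ∈ Submodule.span ℂ (Set.range fun j : Fin (n + 1) => psi n (j : ℕ)) := by
  obtain ⟨a, ha, b, hb, rfl⟩ := Submodule.mem_sup.mp (Sinv_le_sup hn hψ)
  obtain ⟨β, rfl⟩ := (Submodule.mem_span_range_iff_exists_fun ℂ).mp hb
  have hker : ∀ p ∈ Finset.Icc 1 (n - 1), killingOp n p a = 0 := by
    intro p hp
    have hle : Submodule.span ℂ (Set.range fun j : Fin (n + 1) => psi n (j : ℕ)) ≤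
        LinearMap.ker (killingOp n p) := by
      rw [Submodule.span_le]
      rintro _ ⟨j, rfl⟩
      exact killingOp_psi hn hp j
    exact hle ha
  have hsum : ∑ k : Fin (n - 1), β k • (yGen n 0 * om n ^ ((k : ℕ) + 1)) = 0 := by
    have h2 : (2 : ℂ) • ∑ k : Fin (n - 1), β k • (yGen n 0 * om n ^ ((k : ℕ) + 1)) = 0 := by
      calc _ = ∑ p ∈ Finset.Icc 1 (n - 1), yGen n 0 * (yGen n (2 * p - 1) *
              killingOp n p (∑ k : Fin (n - 1), β k • (yGen n 0 * om n ^ (k : ℕ)))) := by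
            simp only [map_sum, map_smul, Finset.mul_sum, mul_smul_comm]
            rw [Finset.sum_comm, Finset.smul_sum]
            refine Finset.sum_congr rfl fun k _ => ?_
            rw [← Finset.smul_sum, sum_yGen_mul_killingOp hn, smul_comm]
        _ = 0 := by
            refine Finset.sum_eq_zero fun p hp => ?_
            have := h p hp
            rw [map_add, hker p hp, zero_add] at this
            rw [this, mul_zero, mul_zero]
    exact (smul_eq_zero.mp h2).resolve_left two_ne_zero
  have hinj : Function.Injective
      (fun k : Fin (n - 1) => (⟨(k : ℕ) + 1, by omega⟩ : Fin n)) := by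
    intro k l hkl
    simpa [Fin.ext_iff] using hkl
  have hβ := Fintype.linearIndependent_iff.mp
    ((linearIndependent_yGen_zero_mul_om_pow hn).comp _ hinj) β hsum
  simpa [hβ] using ha

end KillingOperator

/-- On a simply-connected homogeneous 3-Sasakian manifold of dimension
`4n-1` (`n ≥ 2`), in the exterior-form model: (1) the `n+1` spinors
`ψ_k = ω^{k+1} - i(k+1)·y₁∧ω^k` (`-1 ≤ k ≤ n-1`, here reindexed by `j = k+1`) are linearly
independent; (2) each `ψ_k` satisfies the algebraic Killing equation
`(c_{4p} + c₁∘c_{4p+1} + c₂∘c_{4p+2} + c₃∘c_{4p+3})(ψ_k) = 0` for all `p = 1,…,n-1`;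
and (3) every invariant spinor `ψ ∈ Σ_inv` satisfying these equations lies in
`span_ℂ{ψ_{-1},…,ψ_{n-1}}`. -/
theorem invariant_killing_spinor_basis (n : ℕ) (hn : 2 ≤ n) :
    LinearIndependent ℂ (fun j : Fin (n + 1) => psi n (j : ℕ)) ∧
    (∀ j ≤ n, ∀ p ∈ Finset.Icc 1 (n - 1),
      (cop n (4 * p) + cop n 1 ∘ₗ cop n (4 * p + 1) + cop n 2 ∘ₗ cop n (4 * p + 2) +
        cop n 3 ∘ₗ cop n (4 * p + 3)) (psi n j) = 0) ∧
    (∀ ψ ∈ Sinv n,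
      (∀ p ∈ Finset.Icc 1 (n - 1),
        (cop n (4 * p) + cop n 1 ∘ₗ cop n (4 * p + 1) + cop n 2 ∘ₗ cop n (4 * p + 2) +
          cop n 3 ∘ₗ cop n (4 * p + 3)) ψ = 0) →
      ψ ∈ Submodule.span ℂ (Set.range fun j : Fin (n + 1) => psi n (j : ℕ))) := by
  exact ⟨linearIndependent_psi hn, fun j _ p hp => killingOp_psi hn hp j,
    fun _ hψ h => mem_span_psi_of_killingOp_eq_zero hn hψ h⟩
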